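/- The polytope S is combinatorially equivalent to the cube C = [0,1]³: there exists an inclusion-preserving bijection (an order isomorphism) between the set of exposed faces of S, partially ordered by inclusion, and the set of exposed faces of C, partially ordered by inclusion. -/

import Mathlib

/-- The polytope S given by the six inequalities. -/
def S : Set (Fin 3 → ℝ) :=
  {x | 25 - 2 * x 0 - 25 * x 1 + 10 * x 2 ≥ 0 ∧
       -2 + 25 * x 0 + 2 * x 1 + 10 * x 2 ≥ 0 ∧
       25 - 2 * x 0 + 25 * x 1 + 10 * x 2 ≥ 0 ∧
       -2 + 25 * x 0 - 2 * x 1 + 10 * x 2 ≥ 0 ∧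
       -(x 1) - x 2 ≥ 0 ∧
       2 - x 1 + x 2 ≥ 0}

/-- The 3-cube [0,1]³. -/
def C : Set (Fin 3 → ℝ) := {x | ∀ i, x i ∈ Set.Icc (0 : ℝ) 1}

open Set Filter Topology

section PolyhedralFaces

variable {ι E : Type*} [AddCommGroup E] [Module ℝ E] [TopologicalSpace E]

/-- The face, cut out by the inequalities indexed by `K`, of the polyhedron
`{x | ∀ i, 0 ≤ a i x + c i}`. -/
def polyhedralFace (a : ι → E →L[ℝ] ℝ) (c : ι → ℝ) (K : Set ι) : Set E :=
  {x | (∀ i, 0 ≤ a i x + c i) ∧ ∀ i ∈ K, a i x + c i = 0}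

theorem isExposed_polyhedralFace [Fintype ι] (a : ι → E →L[ℝ] ℝ) (c : ι → ℝ) (K : Set ι) :
    IsExposed ℝ (polyhedralFace a c ∅) (polyhedralFace a c K) := by
  classical
  rintro ⟨p, hp⟩
  let s : Finset ι := Finset.univ.filter (· ∈ K)
  have hs : ∀ x, (-∑ i ∈ s, a i) x = ∑ i ∈ s, c i - ∑ i ∈ s, (a i x + c i) := by
    intro x
    simp [Finset.sum_add_distrib]
  have zero_sum : ∀ x ∈ polyhedralFace a c K, ∑ i ∈ s, (a i x + c i) = 0 := fun x hx =>
    Finset.sum_eq_zero fun i hi => hx.2 i (by simpa [s] using hi)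
  refine ⟨-∑ i ∈ s, a i, Subset.antisymm (fun x hx => ⟨⟨hx.1, by simp⟩, fun y hy => ?_⟩) ?_⟩
  · rw [hs, hs, zero_sum x hx]
    linarith [Finset.sum_nonneg fun i (_ : i ∈ s) => hy.1 i]
  · rintro x ⟨hx, hmax⟩
    have h := hmax p ⟨hp.1, by simp⟩
    rw [hs, hs, zero_sum p hp] at h
    have h0 : ∑ i ∈ s, (a i x + c i) = 0 :=
      le_antisymm (by linarith) (Finset.sum_nonneg fun i _ => hx.1 i)
    rw [Finset.sum_eq_zero_iff_of_nonneg fun i _ => hx.1 i] at h0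
    exact ⟨hx.1, fun i hi => h0 i (by simpa [s] using hi)⟩

/-- A nonempty convex subset of a polyhedron contains a point at which every inequality that is
not tight on the whole subset is strict. -/
theorem exists_forall_pos_of_convex [Finite ι] {a : ι → E →L[ℝ] ℝ} {c : ι → ℝ} {F : Set E}
    (hF : Convex ℝ F) (hne : F.Nonempty) (hsub : F ⊆ polyhedralFace a c ∅) :
    ∃ x ∈ F, ∀ i, (∃ y ∈ F, a i y + c i ≠ 0) → 0 < a i x + c i := by
  classical
  have := Fintype.ofFinite ι
  suffices h : ∀ s : Finset ι, ∃ x ∈ F, ∀ i ∈ s, (∃ y ∈ F, a i y + c i ≠ 0) → 0 < a i x + c i by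
    obtain ⟨x, hx, h⟩ := h Finset.univ
    exact ⟨x, hx, fun i => h i (Finset.mem_univ i)⟩
  intro s
  induction s using Finset.induction_on with
  | empty => exact hne.imp fun x hx => ⟨hx, by simp⟩
  | insert j s _ ih =>
    obtain ⟨x, hx, h⟩ := ih
    by_cases hj : ∃ y ∈ F, a j y + c j ≠ 0
    · obtain ⟨y, hy, hyj⟩ := hj
      have hyj' : 0 < a j y + c j := lt_of_le_of_ne ((hsub hy).1 j) hyj.symm
      have value : ∀ i, a i ((1 / 2 : ℝ) • x + (1 / 2 : ℝ) • y) + c i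
          = ((a i x + c i) + (a i y + c i)) / 2 := by
        intro i
        simp only [map_add, map_smul, smul_eq_mul]
        ring
      refine ⟨(1 / 2 : ℝ) • x + (1 / 2 : ℝ) • y,
        hF hx hy (by norm_num) (by norm_num) (by norm_num), fun i hi hi' => ?_⟩
      rw [value]
      rcases Finset.mem_insert.1 hi with rfl | hi
      · linarith [(hsub hx).1 i]
      · linarith [h i hi hi', (hsub hy).1 i]
    · refine ⟨x, hx, fun i hi hi' => ?_⟩
      rcases Finset.mem_insert.1 hi with rfl | hi
      · exact absurd hi' hj
      · exact h i hi hi'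

theorem IsExposed.exists_eq_polyhedralFace [Finite ι] {a : ι → E →L[ℝ] ℝ} {c : ι → ℝ} {F : Set E}
    (hF : IsExposed ℝ (polyhedralFace a c ∅) F) (hne : F.Nonempty) :
    ∃ K, polyhedralFace a c K = F := by
  have hsub := hF.subset
  have hP : Convex ℝ (polyhedralFace a c ∅) := by
    intro x hx y hy s t hs ht hst
    refine ⟨fun i => ?_, by simp⟩
    have : a i (s • x + t • y) + c i = s * (a i x + c i) + t * (a i y + c i) := by
      simp only [map_add, map_smul, smul_eq_mul]
      linear_combination (-c i) * hst
    rw [this]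
    exact add_nonneg (mul_nonneg hs (hx.1 i)) (mul_nonneg ht (hy.1 i))
  obtain ⟨x, hx, hpos⟩ := exists_forall_pos_of_convex (hF.convex hP) hne hsub
  obtain ⟨l, hl⟩ := hF hne
  refine ⟨{i | ∀ y ∈ F, a i y + c i = 0},
    Subset.antisymm (fun y hy => ?_) fun y hy => ⟨(hsub hy).1, fun i hi => hi y hy⟩⟩
  have value : ∀ i (t : ℝ), a i (x + t • (x - y)) + c i
      = (a i x + c i) + t * ((a i x + c i) - (a i y + c i)) := by
    intro i t
    simp only [map_add, map_smul, map_sub, smul_eq_mul]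
    ring
  have hnear : ∀ᶠ t in 𝓝[>] (0 : ℝ), ∀ i, 0 ≤ a i (x + t • (x - y)) + c i := by
    refine eventually_all.2 fun i => ?_
    simp only [value]
    by_cases hi : ∀ z ∈ F, a i z + c i = 0
    · simp [hi x hx, hy.2 i hi]
    · push Not at hi
      have hcont : Continuous fun t : ℝ =>
          (a i x + c i) + t * ((a i x + c i) - (a i y + c i)) := by fun_prop
      refine nhdsWithin_le_nhds ((hcont.tendsto 0).eventually (le_mem_nhds ?_))
      simpa using hpos i hi
  obtain ⟨t, ht, ht0⟩ := (hnear.and self_mem_nhdsWithin).exists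
  rw [hl] at hx ⊢
  refine ⟨⟨hy.1, by simp⟩, fun z hz => (hx.2 z hz).trans ?_⟩
  have h := hx.2 _ ⟨ht, by simp⟩
  simp only [map_add, map_smul, map_sub, smul_eq_mul] at h
  have ht0 : 0 < t := ht0
  nlinarith

/-- If the inclusions between the polyhedral faces of two polyhedra agree, then their posets of
exposed faces are order-isomorphic. -/
theorem nonempty_orderIso_exposed {E' : Type*} [AddCommGroup E'] [Module ℝ E']
    [TopologicalSpace E'] [Fintype ι]
    {a : ι → E →L[ℝ] ℝ} {c : ι → ℝ} {a' : ι → E' →L[ℝ] ℝ} {c' : ι → ℝ}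
    (hempty : polyhedralFace a c univ = ∅) (hempty' : polyhedralFace a' c' univ = ∅)
    (h : ∀ K L, polyhedralFace a c K ⊆ polyhedralFace a c L ↔
      polyhedralFace a' c' K ⊆ polyhedralFace a' c' L) :
    Nonempty ({F : Set E // IsExposed ℝ (polyhedralFace a c ∅) F} ≃o
      {F : Set E' // IsExposed ℝ (polyhedralFace a' c' ∅) F}) := by
  have hsurj : ∀ F : {F : Set E // IsExposed ℝ (polyhedralFace a c ∅) F},
      ∃ K, polyhedralFace a c K = F.1 := fun F =>
    F.1.eq_empty_or_nonempty.elim (fun h0 => ⟨univ, hempty.trans h0.symm⟩)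
      F.2.exists_eq_polyhedralFace
  have hsurj' : ∀ F : {F : Set E' // IsExposed ℝ (polyhedralFace a' c' ∅) F},
      ∃ K, polyhedralFace a' c' K = F.1 := fun F =>
    F.1.eq_empty_or_nonempty.elim (fun h0 => ⟨univ, hempty'.trans h0.symm⟩)
      F.2.exists_eq_polyhedralFace
  choose k hk using hsurj
  let f : {F : Set E // IsExposed ℝ (polyhedralFace a c ∅) F} ↪o
      {F : Set E' // IsExposed ℝ (polyhedralFace a' c' ∅) F} :=
    OrderEmbedding.ofMapLEIff
      (fun F => ⟨polyhedralFace a' c' (k F), isExposed_polyhedralFace a' c' (k F)⟩)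
      fun F G => by
        change polyhedralFace a' c' (k F) ⊆ polyhedralFace a' c' (k G) ↔ F.1 ⊆ G.1
        rw [← h, hk, hk]
  refine ⟨RelIso.ofSurjective f fun G => ?_⟩
  obtain ⟨K, hK⟩ := hsurj' G
  refine ⟨⟨polyhedralFace a c K, isExposed_polyhedralFace a c K⟩, Subtype.ext ?_⟩
  rw [← hK]
  exact Subset.antisymm ((h _ _).1 (hk _).subset) ((h _ _).1 (hk ⟨polyhedralFace a c K, isExposed_polyhedralFace a c K⟩).superset)

/-- Inequalities `(j, b)`, for `j : κ` and `b : Bool`, whose polyhedron has the vertex-facet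
incidences of a cube: opposite facets are disjoint, and for every choice of one facet from each
opposite pair there is a point lying on exactly these facets. -/
structure IsCubical {κ : Type*} (a : κ × Bool → E →L[ℝ] ℝ) (c : κ × Bool → ℝ) : Prop where
  disjoint : ∀ x ∈ polyhedralFace a c ∅, ∀ j,
    a (j, false) x + c (j, false) = 0 → a (j, true) x + c (j, true) ≠ 0
  exists_vertex : ∀ ε : κ → Bool, ∃ x, ∀ j,
    a (j, ε j) x + c (j, ε j) = 0 ∧ 0 < a (j, !ε j) x + c (j, !ε j)

namespace IsCubical

variable {κ : Type*} {a : κ × Bool → E →L[ℝ] ℝ} {c : κ × Bool → ℝ}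

theorem polyhedralFace_eq_empty (h : IsCubical a c) {K : Set (κ × Bool)} {j : κ}
    (hf : (j, false) ∈ K) (ht : (j, true) ∈ K) : polyhedralFace a c K = ∅ :=
  eq_empty_of_forall_notMem fun x hx =>
    h.disjoint x ⟨hx.1, by simp⟩ j (hx.2 _ hf) (hx.2 _ ht)

theorem polyhedralFace_subset_iff (h : IsCubical a c) (K L : Set (κ × Bool)) :
    polyhedralFace a c K ⊆ polyhedralFace a c L ↔
      (∃ j, (j, false) ∈ K ∧ (j, true) ∈ K) ∨ L ⊆ K := by
  classical
  constructor
  · intro hKL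
    by_contra! hcon
    obtain ⟨hK, hLK⟩ := hcon
    obtain ⟨⟨j, b⟩, hL, hjK⟩ := not_subset.1 hLK
    obtain ⟨x, hx⟩ := h.exists_vertex fun i => if i = j then !b else decide ((i, true) ∈ K)
    have hxK : x ∈ polyhedralFace a c K := by
      refine ⟨fun ⟨i, d⟩ => ?_, fun ⟨i, d⟩ hi => ?_⟩
      · obtain ⟨h0, h1⟩ := hx i
        generalize (if i = j then !b else decide ((i, true) ∈ K)) = e at h0 h1
        rcases Bool.eq_or_eq_not d e with rfl | rfl
        · exact h0.ge
        · exact h1.le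
      · have hd : (if i = j then !b else decide ((i, true) ∈ K)) = d := by
          split_ifs with hij
          · subst hij
            cases b <;> cases d <;> simp_all
          · cases d
            · simpa using hK i hi
            · simpa using hi
        have h0 := (hx i).1
        rwa [hd] at h0
    have hj := (hx j).2
    simp only [if_true, Bool.not_not] at hj
    exact hj.ne' ((hKL hxK).2 _ hL)
  · rintro (⟨j, hf, ht⟩ | hLK)
    · rw [h.polyhedralFace_eq_empty hf ht]
      exact empty_subset _
    · exact fun x hx => ⟨hx.1, fun i hi => hx.2 i (hLK hi)⟩

theorem nonempty_orderIso_exposed [Fintype κ] [Nonempty κ] {E' : Type*} [AddCommGroup E']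
    [Module ℝ E'] [TopologicalSpace E'] {a' : κ × Bool → E' →L[ℝ] ℝ} {c' : κ × Bool → ℝ}
    (h : IsCubical a c) (h' : IsCubical a' c') :
    Nonempty ({F : Set E // IsExposed ℝ (polyhedralFace a c ∅) F} ≃o
      {F : Set E' // IsExposed ℝ (polyhedralFace a' c' ∅) F}) :=
  have ⟨j⟩ := ‹Nonempty κ›
  _root_.nonempty_orderIso_exposed
    (h.polyhedralFace_eq_empty (mem_univ (j, false)) (mem_univ (j, true)))
    (h'.polyhedralFace_eq_empty (mem_univ (j, false)) (mem_univ (j, true)))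
    fun K L => by rw [h.polyhedralFace_subset_iff, h'.polyhedralFace_subset_iff]

end IsCubical

end PolyhedralFaces

/-- The linear form on `ℝ³` with the given coefficients. -/
noncomputable def linearForm (u : Fin 3 → ℝ) : (Fin 3 → ℝ) →L[ℝ] ℝ :=
  ∑ j, u j • ContinuousLinearMap.proj j

theorem linearForm_apply (u x : Fin 3 → ℝ) :
    linearForm u x = u 0 * x 0 + u 1 * x 1 + u 2 * x 2 := by
  simp [linearForm, Fin.sum_univ_three]

/-- Coefficients of the inequalities defining `S`, in opposite pairs. -/
def normalS (i : Fin 3 × Bool) : Fin 3 → ℝ :=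
  ![bif i.2 then ![25, 2, 10] else ![-2, -25, 10],
    bif i.2 then ![25, -2, 10] else ![-2, 25, 10],
    bif i.2 then ![0, -1, 1] else ![0, -1, -1]] i.1

/-- Constant terms of the inequalities defining `S`, in opposite pairs. -/
def offsetS (i : Fin 3 × Bool) : ℝ :=
  ![bif i.2 then -2 else 25, bif i.2 then -2 else 25, bif i.2 then 2 else 0] i.1

theorem polyhedralFace_S :
    polyhedralFace (fun i => linearForm (normalS i)) offsetS ∅ = S := by
  ext x
  simp only [polyhedralFace, S, Prod.forall, Fin.forall_fin_succ, Bool.forall_bool, mem_ofPred_eq,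
    linearForm_apply]
  simp [normalS, offsetS]
  constructor
  · rintro ⟨⟨h0, h1⟩, ⟨h2, h3⟩, h4, h5⟩
    refine ⟨?_, ?_, ?_, ?_, ?_, ?_⟩ <;> linarith
  · rintro ⟨h0, h1, h2, h3, h4, h5⟩
    refine ⟨⟨?_, ?_⟩, ⟨?_, ?_⟩, ?_, ?_⟩ <;> linarith

theorem isCubical_S : IsCubical (fun i => linearForm (normalS i)) offsetS where
  disjoint := by
    intro x hx
    rw [polyhedralFace_S] at hx
    obtain ⟨h0, h1, h2, h3, h4, h5⟩ := hx
    simp only [Fin.forall_fin_succ, linearForm_apply]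
    simp [normalS, offsetS]
    refine ⟨fun h h' => ?_, fun h h' => ?_, fun h h' => ?_⟩ <;> linarith
  exists_vertex := by
    intro ε
    simp only [Fin.forall_fin_succ, linearForm_apply]
    simp only [normalS, offsetS]
    rcases h0 : ε 0 <;> rcases h1 : ε 1 <;> rcases h2 : ε 2
    on_goal 1 => use ![25 / 2, 0, 0]
    on_goal 2 => use ![5 / 2, 0, -2]
    on_goal 3 => use ![370 / 899, 621 / 899, -621 / 899]
    on_goal 4 => use ![290 / 359, 81 / 359, -637 / 359]
    on_goal 5 => use ![-170 / 359, -621 / 359, 621 / 359]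
    on_goal 6 => use ![830 / 899, -81 / 899, -1879 / 899]
    on_goal 7 => use ![2 / 25, 0, 0]
    on_goal 8 => use ![22 / 25, 0, -2]
    all_goals simp [*]; norm_num

/-- Coefficients of the inequalities `0 ≤ x j` and `0 ≤ 1 - x j` defining the cube. -/
def normalC (i : Fin 3 × Bool) : Fin 3 → ℝ :=
  Pi.single i.1 (bif i.2 then -1 else 1)

/-- Constant terms of the inequalities `0 ≤ x j` and `0 ≤ 1 - x j` defining the cube. -/
def offsetC (i : Fin 3 × Bool) : ℝ := bif i.2 then 1 else 0

theorem linearForm_normalC (i : Fin 3 × Bool) (x : Fin 3 → ℝ) :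
    linearForm (normalC i) x = (bif i.2 then -1 else 1) * x i.1 := by
  simp [linearForm, normalC, Pi.single_apply]

theorem polyhedralFace_C :
    polyhedralFace (fun i => linearForm (normalC i)) offsetC ∅ = C := by
  ext x
  simp [polyhedralFace, C, linearForm_normalC, offsetC]

theorem isCubical_C : IsCubical (fun i => linearForm (normalC i)) offsetC where
  disjoint := by
    intro x _ j
    simp only [linearForm_normalC, offsetC, cond_false, cond_true]
    intro h h'
    linarith
  exists_vertex := by
    intro ε
    refine ⟨fun j => bif ε j then 1 else 0, fun j => ?_⟩
    simp only [linearForm_normalC, offsetC]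
    cases ε j <;> norm_num

/-- S is combinatorially equivalent to the cube: the posets of exposed faces
(ordered by inclusion) are order-isomorphic. -/
theorem stmt_7 :
    Nonempty
      ({F : Set (Fin 3 → ℝ) // IsExposed ℝ S F} ≃o
       {F : Set (Fin 3 → ℝ) // IsExposed ℝ C F}) := by
  rw [← polyhedralFace_S, ← polyhedralFace_C]
  exact isCubical_S.nonempty_orderIso_exposed isCubical_C
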